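/- arXiv:2304.06616 — 8 statements merged into one kernel-verified Lean document; each statement's English description precedes it below -/
import Mathlib

section
/- Let X₁ = X₂ = ℝ^d, let μ₁ = μ₂ be the uniform distribution on [0,1]^d, and let c(x,y) = Σ_{i=1}^d |x_i − y_i|. Let q > 1 and set k = [(q−1)/(((q−1)d+q) 2^{((q−1)d+1)/(q−1)}) · (q/(q−1))^{q/(q−1)}]^{(q−1)/((q−1)d+1)}. Then for every ε > 0 with k ε^{1/((q−1)d+1)} ≤ 1: OT_{q,ε} − OT ≥ K̃_{1,q} ε^{1/((q−1)d+1)} − K̃_{2,q} ε, where K̃_{1,q} = (((q−1)d+1)/((q−1)d+q)) · [(q−1)/(((q−1)d+q) 2^{((q−1)d+1)/(q−1)}) · (q/(q−1))^{q/(q−1)}]^{(q−1)/((q−1)d+1)} and K̃_{2,q} = (1 + 2^{((q−1)d+1)/(q−1)}) q^{−q/(q−1)}. -/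
open MeasureTheory Filter Topology
open scoped ENNReal Classical

noncomputable section

/-- `π` is a coupling of `μ` and `ν`. -/
def IsCoupling {X Y : Type*} [MeasurableSpace X] [MeasurableSpace Y]
    (π : Measure (X × Y)) (μ : Measure X) (ν : Measure Y) : Prop :=
  π.map Prod.fst = μ ∧ π.map Prod.snd = ν

/-- Tsallis relative entropy `D_q(μ, ν) = (1/(q-1)) ∫ ((dμ/dν)^q - dμ/dν) dν` if `μ ≪ ν`,
and `∞` otherwise; with values in `[0, ∞]`. -/
def tsallisDiv {X : Type*} [MeasurableSpace X] (q : ℝ) (μ ν : Measure X) : ℝ≥0∞ :=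
  if μ ≪ ν then
    (∫⁻ x, μ.rnDeriv ν x ^ q ∂ν - ∫⁻ x, μ.rnDeriv ν x ∂ν) / ENNReal.ofReal (q - 1)
  else ⊤

/-- The Tsallis entropic regularized optimal transport value `OT_{q,ε}`. -/
def OTq {X₁ X₂ : Type*} [MeasurableSpace X₁] [MeasurableSpace X₂]
    (q ε : ℝ) (c : X₁ × X₂ → ℝ) (μ₁ : Measure X₁) (μ₂ : Measure X₂) : ℝ≥0∞ :=
  ⨅ (π : Measure (X₁ × X₂)) (_ : IsCoupling π μ₁ μ₂),
    (∫⁻ z, ENNReal.ofReal (c z) ∂π + ENNReal.ofReal ε * tsallisDiv q π (μ₁.prod μ₂))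

/-- The Monge–Kantorovich optimal transport value `OT`. -/
def OT0 {X₁ X₂ : Type*} [MeasurableSpace X₁] [MeasurableSpace X₂]
    (c : X₁ × X₂ → ℝ) (μ₁ : Measure X₁) (μ₂ : Measure X₂) : ℝ≥0∞ :=
  ⨅ (π : Measure (X₁ × X₂)) (_ : IsCoupling π μ₁ μ₂), ∫⁻ z, ENNReal.ofReal (c z) ∂π


lemma ts_one (s : ℝ) (hs : 0 < s) : (1+s) * (1+1/s)^s ≤ 1 + 2 * 2^s := by
  have hl := Real.log_two_gt_d9
  have h2 : ∀ a : ℝ, (2:ℝ)^s ≥ 2^a * (1 + (s-a) * Real.log 2) := by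
    intro a
    have : (2:ℝ)^s = 2^a * 2^(s-a) := by
      rw [← Real.rpow_add two_pos]; ring_nf
    rw [this]
    have h3 : (2:ℝ)^(s-a) = Real.exp ((s-a) * Real.log 2) := by
      rw [Real.rpow_def_of_pos two_pos, mul_comm]
    rw [h3]
    have := Real.add_one_le_exp ((s-a) * Real.log 2)
    gcongr; linarith
  have h1s : -1 ≤ 1/s := by
    have : 0 < 1/s := by positivity
    linarith
  rcases le_total s 1 with h | h
  · have hb : (1+1/s)^s ≤ 2 := by
      have := rpow_one_add_le_one_add_mul_self (s := 1/s) (p := s) h1s hs.le h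
      rw [mul_one_div_cancel hs.ne'] at this; linarith
    have := h2 0
    simp at this
    nlinarith
  rcases le_total s 2 with h' | h'
  · have hb : (1+1/s)^(s/2) ≤ 3/2 := by
      have := rpow_one_add_le_one_add_mul_self (s := 1/s) (p := s/2) h1s (by linarith) (by linarith)
      have e : s/2 * (1/s) = 1/2 := by field_simp
      rw [e] at this; linarith
    have hc : (1+1/s)^s ≤ 9/4 := by
      have e : (1+1/s)^s = ((1+1/s)^(s/2))^2 := by
        rw [← Real.rpow_natCast, ← Real.rpow_mul (by positivity)]; congr 1; push_cast; ring
      have : 0 ≤ (1+1/s)^(s/2) := by positivity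
      rw [e]; nlinarith
    have := h2 1
    simp at this
    nlinarith
  · have hc : (1+1/s)^s ≤ Real.exp 1 := by
      have h1 : 1 + 1/s ≤ Real.exp (1/s) := by have := Real.add_one_le_exp (1/s); linarith
      calc (1+1/s)^s ≤ (Real.exp (1/s))^s := by gcongr
        _ = Real.exp 1 := by rw [← Real.exp_mul]; congr 1; field_simp
    have := h2 2
    have he := Real.exp_one_lt_d9
    norm_num at this
    nlinarith

lemma ts_const (d : ℕ) (hd : 1 ≤ d) (q : ℝ) (hq : 1 < q) :
   1/(q-1) ≤ (1 + (2 : ℝ) ^ (((q - 1) * (d : ℝ) + 1) / (q - 1))) * q ^ (-(q / (q - 1))) := by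
  obtain ⟨s, hs, rfl⟩ : ∃ s : ℝ, 0 < s ∧ q = 1 + 1/s :=
    ⟨1/(q-1), by have : 0 < q - 1 := by linarith
                 positivity, by simp⟩
  have e1 : ((1 + 1/s - 1) * (d:ℝ) + 1) / (1 + 1/s - 1) = d + s := by field_simp; ring
  have e2 : (1+1/s) / (1 + 1/s - 1) = s + 1 := by field_simp; ring
  rw [e1, e2, Real.rpow_neg (by positivity), ← div_eq_mul_inv, le_div_iff₀ (by positivity),
    Real.rpow_add_one (by positivity)]
  have h := ts_one s hs
  have e3 : 1 / (1 + 1 / s - 1) * ((1 + 1 / s) ^ s * (1 + 1 / s)) = (1+s) * (1+1/s)^s := by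
    field_simp; ring
  rw [e3]
  have : (2:ℝ)^((d:ℝ)+s) ≥ 2 * 2^s := by
    rw [Real.rpow_add two_pos]
    have : (2:ℝ)^(d:ℝ) ≥ 2 := by
      calc (2:ℝ)^(d:ℝ) ≥ 2^(1:ℝ) := Real.rpow_le_rpow_of_exponent_le (by norm_num) (by exact_mod_cast hd)
        _ = 2 := by simp
    gcongr
  linarith

lemma ts_young (q a t p : ℝ) (hq : 1 < q) (ha : 0 < a) (hp : 0 ≤ p) :
    t * p ≤ a * p^q + (a*q)^(-(1/(q-1))) / (q/(q-1)) * (max t 0)^(q/(q-1)) := by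
  have hq0 : 0 < q := by linarith
  have hq1 : 0 < q - 1 := by linarith
  have h := Real.young_inequality_of_nonneg (a := (a*q)^(1/q) * p) (b := max t 0 * (a*q)^(-(1/q)))
    (p := q) (q := q/(q-1)) (by positivity) (by positivity) (Real.HolderConjugate.conjExponent hq)
  have haq : 0 ≤ a * q := by positivity
  rw [Real.mul_rpow (Real.rpow_nonneg haq _) hp,
    Real.mul_rpow (le_max_right t 0) (Real.rpow_nonneg haq _),
    ← Real.rpow_mul haq, ← Real.rpow_mul haq] at h
  have e1 : 1/q*q = 1 := by field_simp
  have e2 : -(1/q) * (q/(q-1)) = -(1/(q-1)) := by field_simp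
  rw [e1, e2, Real.rpow_one] at h
  have e3 : (a*q)^(1/q) * p * (max t 0 * (a*q)^(-(1/q))) = max t 0 * p := by
    have : (a*q)^(1/q) * (a*q)^(-(1/q)) = 1 := by
      rw [← Real.rpow_add (by positivity)]; simp
    linear_combination (max t 0 * p) * this
  rw [e3] at h
  calc t * p ≤ max t 0 * p := by gcongr; exact le_max_left _ _
    _ ≤ _ := h
    _ = _ := by field_simp

lemma ts_final (d : ℕ) (hd : 1 ≤ d) (q : ℝ) (hq : 1 < q)
    (ε : ℝ) (hε : 0 < ε) (l : ℝ) (hl : l = ((q - 1) / (((q - 1) * (d : ℝ) + q)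
                  * (2 : ℝ) ^ (((q - 1) * (d : ℝ) + 1) / (q - 1)))
                * (q / (q - 1)) ^ (q / (q - 1))) ^ ((q - 1) / ((q - 1) * (d : ℝ) + 1))
            * ε ^ (1 / ((q - 1) * (d : ℝ) + 1))) :
   0 < l ∧ (((q - 1) * (d : ℝ) + 1) / ((q - 1) * (d : ℝ) + q))
            * ((q - 1) / (((q - 1) * (d : ℝ) + q)
                  * (2 : ℝ) ^ (((q - 1) * (d : ℝ) + 1) / (q - 1)))
                * (q / (q - 1)) ^ (q / (q - 1))) ^ ((q - 1) / ((q - 1) * (d : ℝ) + 1))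
            * ε ^ (1 / ((q - 1) * (d : ℝ) + 1))
          - (1 + (2 : ℝ) ^ (((q - 1) * (d : ℝ) + 1) / (q - 1)))
            * q ^ (-(q / (q - 1))) * ε ≤
     l - (ε/(q-1) + (ε/(q-1)*q)^(-(1/(q-1))) / (q/(q-1)) * l^(q/(q-1)) * (2*l)^d) := by
  have hc := ts_const d hd q hq
  obtain ⟨s, hs, hqs⟩ : ∃ s : ℝ, 0 < s ∧ s = 1/(q-1) :=
    ⟨1/(q-1), by have : 0 < q - 1 := by linarith
                 positivity, rfl⟩
  have hq0 : 0 < q := by linarith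
  have hq1 : 0 < q - 1 := by linarith
  have hd0 : (0:ℝ) ≤ d := Nat.cast_nonneg d
  set r := q/(q-1) with hr
  have hr0 : 0 < r := by positivity
  have hrs : r = s + 1 := by rw [hr, hqs]; field_simp; ring
  have e1 : ((q - 1) * (d : ℝ) + 1) / (q - 1) = d + s := by rw [hqs]; field_simp
  have e1' : ((q - 1) * (d : ℝ) + 1) / ((q - 1) * (d : ℝ) + q) = (d+s)/(r+d) := by rw [hqs, hr]; field_simp; ring
  set B := (q - 1) / (((q - 1) * (d : ℝ) + q)
                  * (2 : ℝ) ^ (((q - 1) * (d : ℝ) + 1) / (q - 1))) * r ^ r with hB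
  have hB0 : 0 < B := by positivity
  have hBe : B = r^r / ((r+d) * (2^d * 2^s)) := by
    rw [hB, e1, Real.rpow_add two_pos, Real.rpow_natCast, hr]
    field_simp; ring
  have hl0 : 0 < l := by rw [hl]; positivity
  have hlp : l^((d:ℝ)+s) = B * ε^s := by
    rw [hl, Real.mul_rpow (by positivity) (by positivity), ← Real.rpow_mul (by positivity),
      ← Real.rpow_mul (by positivity)]
    have a1 : (q - 1) / ((q - 1) * ↑d + 1) * (↑d + s) = 1 := by rw [hqs]; field_simp
    have a2 : 1 / ((q - 1) * ↑d + 1) * (↑d + s) = s := by rw [hqs]; field_simp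
    rw [a1, a2, Real.rpow_one]
  refine ⟨hl0, ?_⟩
  have hM : (ε/(q-1)*q)^(-(1/(q-1))) / r * l^r * (2*l)^d ≤ l / (r+d) := by
    have b1 : ε/(q-1)*q = ε * r := by rw [hr]; ring
    have b2 : l^r * l^d = l * l^((d:ℝ)+s) := by
      rw [hrs, Real.rpow_add hl0, Real.rpow_add hl0, Real.rpow_natCast, Real.rpow_one]; ring
    have b3 : (ε*r)^(-s) * (ε^s * r^s) = 1 := by
      rw [← Real.mul_rpow hε.le hr0.le, ← Real.rpow_add (by positivity)]; simp
    have b4 : r^r = r^s * r := by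
      have := Real.rpow_add_one hr0.ne' s
      rwa [← hrs] at this
    have b5 : (1:ℝ) ≤ 2^s := Real.one_le_rpow (by norm_num) hs.le
    rw [b1, ← hqs]
    calc (ε*r)^(-s) / r * l^r * (2*l)^d = (ε*r)^(-s) / r * 2^d * (l^r * l^d) := by rw [mul_pow]; ring
      _ = (ε*r)^(-s) / r * 2^d * (l * (r^s * r / ((r+d) * (2^d * 2^s)) * ε^s)) := by
        rw [b2, hlp, hBe, b4]
      _ = ((ε*r)^(-s) * (ε^s * r^s)) * (l / (r+d)) / 2^s := by field_simp
      _ = l / (r+d) / 2^s := by rw [b3, one_mul]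
      _ ≤ l / (r+d) := div_le_self (by positivity) b5
  rw [mul_assoc (((q - 1) * (d : ℝ) + 1) / ((q - 1) * (d : ℝ) + q)), ← hl, e1']
  have b6 : (d+s)/(r+d) * l = l - l/(r+d) := by rw [hrs]; field_simp; ring
  rw [b6]
  have b7 : ε/(q-1) = 1/(q-1)*ε := by ring
  have := mul_le_mul_of_nonneg_right hc hε.le
  rw [← b7] at this
  linarith

lemma ts_prob (d : ℕ) : IsProbabilityMeasure
    ((volume : Measure (Fin d → ℝ)).restrict (Set.Icc 0 1)) := by
  constructor
  rw [Measure.restrict_apply_univ, Real.volume_Icc_pi]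
  simp

lemma ts_vol (d : ℕ) (l : ℝ) (hl : 0 < l) (μ : Measure (Fin d → ℝ)) [IsProbabilityMeasure μ]
    (hμ : μ ≤ volume) :
    (μ.prod μ) {z : (Fin d → ℝ) × (Fin d → ℝ) | dist z.2 z.1 ≤ l} ≤ ENNReal.ofReal ((2*l)^d) := by
  have hm : MeasurableSet {z : (Fin d → ℝ) × (Fin d → ℝ) | dist z.2 z.1 ≤ l} :=
    (isClosed_le (by fun_prop) (by fun_prop)).measurableSet
  rw [Measure.prod_apply hm]
  calc _ ≤ ∫⁻ x, ENNReal.ofReal ((2*l)^d) ∂μ := by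
        apply lintegral_mono
        intro x
        have : (Prod.mk x ⁻¹' {z : (Fin d → ℝ) × (Fin d → ℝ) | dist z.2 z.1 ≤ l}) =
          Metric.closedBall x l := by ext y; simp
        simp only [this]
        refine (hμ _).trans ?_
        rw [Real.volume_pi_closedBall x hl.le]; simp
    _ = _ := by simp

lemma ts_main (d : ℕ) (q ε l : ℝ) (hq : 1 < q) (hε : 0 < ε) (hl : 0 < l)
    (μ : Measure (Fin d → ℝ)) [IsProbabilityMeasure μ]
    (hμ : μ ≤ volume) (π : Measure ((Fin d → ℝ) × (Fin d → ℝ))) (hπ : IsCoupling π μ μ) :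
    ENNReal.ofReal (l - (ε/(q-1) + (ε/(q-1)*q)^(-(1/(q-1))) / (q/(q-1)) * l^(q/(q-1)) * (2*l)^d))
      ≤ ∫⁻ z, ENNReal.ofReal (∑ i, |z.1 i - z.2 i|) ∂π
        + ENNReal.ofReal ε * tsallisDiv q π (μ.prod μ) := by
  have hq1 : 0 < q - 1 := by linarith
  have hq0 : 0 < q := by linarith
  haveI : IsProbabilityMeasure π := by
    constructor
    have h := congrArg (fun m => m Set.univ) hπ.1
    simp only [measure_univ] at h
    rw [Measure.map_apply measurable_fst MeasurableSet.univ] at h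
    simpa using h
  unfold tsallisDiv
  split_ifs with hac
  swap
  · rw [ENNReal.mul_top (by simpa using hε)]; simp
  set ν := μ.prod μ with hν
  set p := π.rnDeriv ν with hp
  have hp1 : ∫⁻ x, p x ∂ν = 1 := by
    rw [Measure.lintegral_rnDeriv hac]; simp
  have hpm : Measurable p := Measure.measurable_rnDeriv _ _
  set c : (Fin d → ℝ) × (Fin d → ℝ) → ℝ := fun z => ∑ i, |z.1 i - z.2 i| with hc
  have hcm : Measurable c := by rw [hc]; fun_prop
  have hc0 : ∀ z, 0 ≤ c z := fun z => Finset.sum_nonneg fun i _ => abs_nonneg _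
  have hcd : ∀ z, c z ≤ l → dist z.2 z.1 ≤ l := by
    intro z hz
    rw [dist_pi_le_iff hl.le]
    intro i
    rw [Real.dist_eq, abs_sub_comm]
    exact (Finset.single_le_sum (f := fun i => |z.1 i - z.2 i|)
      (fun i _ => abs_nonneg _) (Finset.mem_univ i)).trans hz
  set a := ε/(q-1) with ha
  have ha0 : 0 < a := by positivity
  set K := (a*q)^(-(1/(q-1))) / (q/(q-1)) * l^(q/(q-1)) with hK
  have hK0 : 0 ≤ K := by positivity
  set S := {z : (Fin d → ℝ) × (Fin d → ℝ) | dist z.2 z.1 ≤ l} with hS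
  have hSm : MeasurableSet S := (isClosed_le (by fun_prop) (by fun_prop)).measurableSet
  set A := ∫⁻ x, p x ^ q ∂ν with hA
  have key : ENNReal.ofReal l ≤ ∫⁻ z, ENNReal.ofReal (c z) ∂π + ENNReal.ofReal a * A
      + ENNReal.ofReal (K * (2*l)^d) := by
    calc ENNReal.ofReal l = ∫⁻ z, ENNReal.ofReal l * p z ∂ν := by
          rw [lintegral_const_mul _ hpm, hp1, mul_one]
      _ ≤ ∫⁻ z, (p z * ENNReal.ofReal (c z) + ENNReal.ofReal a * p z ^ q
            + S.indicator (fun _ => ENNReal.ofReal K) z) ∂ν := by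
          apply lintegral_mono_ae
          filter_upwards [Measure.rnDeriv_lt_top π ν] with z hz
          change p z < ⊤ at hz
          obtain ⟨u, hu⟩ : ∃ u, u = (p z).toReal := ⟨_, rfl⟩
          have hu0 : 0 ≤ u := hu ▸ ENNReal.toReal_nonneg
          have hpu : p z = ENNReal.ofReal u := by rw [hu, ENNReal.ofReal_toReal hz.ne]
          rw [hpu, ENNReal.ofReal_rpow_of_nonneg hu0 hq0.le, ← ENNReal.ofReal_mul hl.le,
            ← ENNReal.ofReal_mul hu0, ← ENNReal.ofReal_mul ha0.le,
            ← ENNReal.ofReal_add (mul_nonneg hu0 (hc0 z)) (by positivity)]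
          have hy := ts_young q a (l - c z) u hq ha0 hu0
          by_cases hz : z ∈ S
          · rw [Set.indicator_of_mem hz, ← ENNReal.ofReal_add
              (add_nonneg (mul_nonneg hu0 (hc0 z)) (by positivity)) hK0]
            apply ENNReal.ofReal_le_ofReal
            have hmx : max (l - c z) 0 ≤ l := max_le (by linarith [hc0 z]) hl.le
            have : (a*q)^(-(1/(q-1))) / (q/(q-1)) * (max (l - c z) 0)^(q/(q-1)) ≤ K := by
              rw [hK]; gcongr
            linarith
          · rw [Set.indicator_of_notMem hz, add_zero]
            apply ENNReal.ofReal_le_ofReal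
            have hcl : l < c z := by
              by_contra h
              exact hz (hcd z (not_lt.1 h))
            have h1 : l * u ≤ u * c z := by rw [mul_comm]; gcongr
            have h2 : 0 ≤ a * u^q := by positivity
            linarith
      _ = ∫⁻ z, ENNReal.ofReal (c z) ∂π + ENNReal.ofReal a * A + ENNReal.ofReal K * ν S := by
          rw [lintegral_add_right _ (measurable_const.indicator hSm),
            lintegral_add_right _ ((hpm.pow_const q).const_mul _),
            lintegral_const_mul _ (hpm.pow_const q), lintegral_indicator_const hSm,
            lintegral_rnDeriv_mul hac (by fun_prop)]
      _ ≤ _ := by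
          rw [ENNReal.ofReal_mul hK0]
          gcongr
          exact ts_vol d l hl μ hμ
  rw [hp1, ENNReal.ofReal_sub _ (by positivity), tsub_le_iff_right]
  refine key.trans ?_
  have hA' : ENNReal.ofReal a * A ≤ ENNReal.ofReal ε * ((A - 1) / ENNReal.ofReal (q-1))
      + ENNReal.ofReal a := by
    have : ENNReal.ofReal ε * ((A - 1) / ENNReal.ofReal (q-1)) = ENNReal.ofReal a * (A - 1) := by
      rw [ha, ENNReal.ofReal_div_of_pos hq1, div_eq_mul_inv, div_eq_mul_inv]; ring
    rw [this]
    calc ENNReal.ofReal a * A ≤ ENNReal.ofReal a * (A - 1 + 1) := by gcongr; exact le_tsub_add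
      _ = _ := by rw [mul_add, mul_one]
  rw [ENNReal.ofReal_add ha0.le (by positivity)]
  calc _ ≤ ∫⁻ z, ENNReal.ofReal (c z) ∂π + (ENNReal.ofReal ε * ((A - 1) / ENNReal.ofReal (q-1))
      + ENNReal.ofReal a) + ENNReal.ofReal (K * (2*l)^d) := by gcongr
    _ = _ := by ring

lemma ts_OT0 (d : ℕ) (μ : Measure (Fin d → ℝ)) :
    OT0 (fun z : (Fin d → ℝ) × (Fin d → ℝ) => ∑ i, |z.1 i - z.2 i|) μ μ = 0 := by
  have hm : Measurable (fun x : Fin d → ℝ => (x, x)) := by fun_prop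
  refine le_antisymm ?_ bot_le
  unfold OT0
  refine iInf₂_le_of_le (μ.map (fun x => (x, x))) ⟨?_, ?_⟩ ?_
  · rw [Measure.map_map measurable_fst hm]; exact Measure.map_id
  · rw [Measure.map_map measurable_snd hm]; exact Measure.map_id
  · rw [lintegral_map (by fun_prop) hm]; simp

/-- Sharpness of the convergence rate of the Tsallis entropic regularized optimal transport:
lower bound for the uniform distribution on the unit cube with cost `Σᵢ |xᵢ - yᵢ|`. -/
theorem tsallis_rate_sharpness (d : ℕ) (hd : 1 ≤ d) (q : ℝ) (hq : 1 < q)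
    (ε : ℝ) (hε : 0 < ε)
    (hsmall :
      ((q - 1) / (((q - 1) * (d : ℝ) + q) * (2 : ℝ) ^ (((q - 1) * (d : ℝ) + 1) / (q - 1)))
            * (q / (q - 1)) ^ (q / (q - 1))) ^ ((q - 1) / ((q - 1) * (d : ℝ) + 1))
          * ε ^ (1 / ((q - 1) * (d : ℝ) + 1)) ≤ 1) :
    ENNReal.ofReal
        ((((q - 1) * (d : ℝ) + 1) / ((q - 1) * (d : ℝ) + q))
            * ((q - 1) / (((q - 1) * (d : ℝ) + q)
                  * (2 : ℝ) ^ (((q - 1) * (d : ℝ) + 1) / (q - 1)))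
                * (q / (q - 1)) ^ (q / (q - 1))) ^ ((q - 1) / ((q - 1) * (d : ℝ) + 1))
            * ε ^ (1 / ((q - 1) * (d : ℝ) + 1))
          - (1 + (2 : ℝ) ^ (((q - 1) * (d : ℝ) + 1) / (q - 1)))
            * q ^ (-(q / (q - 1))) * ε)
      ≤ OTq q ε (fun z : (Fin d → ℝ) × (Fin d → ℝ) => ∑ i, |z.1 i - z.2 i|)
            (volume.restrict (Set.Icc 0 1)) (volume.restrict (Set.Icc 0 1))
        - OT0 (fun z : (Fin d → ℝ) × (Fin d → ℝ) => ∑ i, |z.1 i - z.2 i|)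
            (volume.restrict (Set.Icc 0 1)) (volume.restrict (Set.Icc 0 1)) := by
  haveI := ts_prob d
  obtain ⟨hl, h⟩ := ts_final d hd q hq ε hε _ rfl
  rw [ts_OT0, tsub_zero]
  unfold OTq
  refine le_iInf₂ fun π hπ => ?_
  exact (ENNReal.ofReal_le_ofReal h).trans
    (ts_main d q ε _ hq hε hl _ Measure.restrict_le_self π hπ)

end
end

section
/- Let X₁ and X₂ be Polish metric spaces, μ₁ a probability measure on X₁, and μ₂ a probability measure on X₂ supported on at most n points (n ≥ 1). Then for every coupling π ∈ Π(μ₁,μ₂) and every 1 < q ≤ 2: D_q(π, μ₁⊗μ₂) ≤ (n^{q−1} − 1)/(q − 1). -/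
open MeasureTheory Filter Topology
open scoped ENNReal Classical

noncomputable section

/-- `μ` is supported on at most `n` points. -/
def SupportedOnAtMost {X : Type*} [MeasurableSpace X] (n : ℕ) (μ : Measure X) : Prop :=
  ∃ s : Finset X, s.card ≤ n ∧ μ (↑s)ᶜ = 0

/-- If the second marginal is supported on at most `n` points, the Tsallis relative entropy
of any coupling with respect to the product measure is at most `φ_q(n) = (n^{q-1}-1)/(q-1)`. -/
theorem tsallisDiv_le_of_finitely_supported
    {X₁ : Type*} [MetricSpace X₁] [CompleteSpace X₁] [TopologicalSpace.SeparableSpace X₁]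
    [MeasurableSpace X₁] [BorelSpace X₁]
    {X₂ : Type*} [MetricSpace X₂] [CompleteSpace X₂] [TopologicalSpace.SeparableSpace X₂]
    [MeasurableSpace X₂] [BorelSpace X₂]
    (μ₁ : Measure X₁) (μ₂ : Measure X₂)
    [IsProbabilityMeasure μ₁] [IsProbabilityMeasure μ₂]
    (n : ℕ) (hn : 1 ≤ n) (hsupp : SupportedOnAtMost n μ₂)
    (π : Measure (X₁ × X₂)) (hπ : IsCoupling π μ₁ μ₂)
    (q : ℝ) (hq₁ : 1 < q) (hq₂ : q ≤ 2) :
    tsallisDiv q π (μ₁.prod μ₂) ≤ ENNReal.ofReal (((n : ℝ) ^ (q - 1) - 1) / (q - 1)) := by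
  obtain ⟨s, hsn, hs0⟩ := hsupp
  obtain ⟨h1, h2⟩ := hπ
  have hπp : IsProbabilityMeasure π := by
    constructor
    have := congrArg (fun m => m Set.univ) h1
    simpa [Measure.map_apply measurable_fst] using this
  set ν := μ₁.prod μ₂ with hν
  let h : X₂ → ℝ≥0∞ := fun y => ∑ a ∈ s, Set.indicator {a} (fun _ => (μ₂ {a})⁻¹) y
  have hm : Measurable h := by
    refine Finset.measurable_sum _ fun a _ => ?_
    exact measurable_const.indicator (measurableSet_singleton a)
  have hh : ∀ a ∈ s, h a = (μ₂ {a})⁻¹ := by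
    intro a ha
    simp only [h]
    rw [Finset.sum_eq_single a]
    · simp
    · intro b _ hb
      simp [Ne.symm hb]
    · intro hb
      exact absurd ha hb
  have key : π ≤ ν.withDensity (fun z => h z.2) := by
    refine Measure.le_iff.2 fun A hA => ?_
    have hp0 : π (Prod.snd ⁻¹' (↑s : Set X₂)ᶜ) = 0 := by
      rw [← Measure.map_apply measurable_snd s.measurableSet.compl, h2, hs0]
    have hsub : A ⊆ (⋃ a ∈ s, A ∩ Prod.snd ⁻¹' {a}) ∪ Prod.snd ⁻¹' (↑s : Set X₂)ᶜ := by
      rintro ⟨x, y⟩ hxy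
      by_cases hy : y ∈ s
      · left
        simp only [Set.mem_iUnion]
        exact ⟨y, hy, hxy, rfl⟩
      · right
        simpa using hy
    have hmeas : ∀ a ∈ s, MeasurableSet (A ∩ Prod.snd ⁻¹' ({a} : Set X₂)) := fun a _ =>
      hA.inter (measurable_snd (measurableSet_singleton a))
    have hle : ∀ a ∈ s, π (A ∩ Prod.snd ⁻¹' {a}) ≤
        ν.withDensity (fun z => h z.2) (A ∩ Prod.snd ⁻¹' {a}) := by
      intro a ha
      by_cases hp : μ₂ {a} = 0
      · refine le_trans (measure_mono Set.inter_subset_right) ?_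
        rw [← Measure.map_apply measurable_snd (measurableSet_singleton a), h2, hp]
        exact zero_le
      · have hAa : MeasurableSet ((fun x => (x, a)) ⁻¹' A : Set X₁) :=
          measurable_prodMk_right hA
        have heq : A ∩ Prod.snd ⁻¹' {a} = ((fun x => (x, a)) ⁻¹' A : Set X₁) ×ˢ {a} := by
          ext ⟨x, y⟩
          simp only [Set.mem_inter_iff, Set.mem_preimage, Set.mem_singleton_iff, Set.mem_prod]
          constructor
          · rintro ⟨h, rfl⟩
            exact ⟨h, rfl⟩
          · rintro ⟨h, rfl⟩
            exact ⟨h, rfl⟩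
        rw [withDensity_apply _ (hmeas a ha)]
        rw [setLIntegral_congr_fun (g := fun _ => (μ₂ {a})⁻¹) (hmeas a ha)
          (fun z hz => by
            have : z.2 = a := hz.2
            simp only [this, hh a ha])]
        rw [setLIntegral_const, heq, hν, Measure.prod_prod, mul_comm (μ₁ _), ← mul_assoc,
          ENNReal.inv_mul_cancel hp (measure_ne_top _ _), one_mul, ← h1,
          Measure.map_apply measurable_fst hAa]
        refine measure_mono ?_
        rintro ⟨x, y⟩ hxy
        exact hxy.1
    calc π A ≤ π (⋃ a ∈ s, A ∩ Prod.snd ⁻¹' {a}) + π (Prod.snd ⁻¹' (↑s : Set X₂)ᶜ) :=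
          (measure_mono hsub).trans (measure_union_le _ _)
      _ ≤ ∑ a ∈ s, π (A ∩ Prod.snd ⁻¹' {a}) := by
          rw [hp0, add_zero]
          exact measure_biUnion_finset_le _ _
      _ ≤ ∑ a ∈ s, ν.withDensity (fun z => h z.2) (A ∩ Prod.snd ⁻¹' {a}) :=
          Finset.sum_le_sum hle
      _ = ν.withDensity (fun z => h z.2) (⋃ a ∈ s, A ∩ Prod.snd ⁻¹' {a}) := by
          rw [measure_biUnion_finset _ hmeas]
          intro a _ b _ hab
          refine Set.disjoint_left.2 ?_
          rintro z ⟨_, hz⟩ ⟨_, hz'⟩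
          exact hab (hz.symm.trans hz')
      _ ≤ _ := by
          refine measure_mono ?_
          simp
  have hac : π ≪ ν := (Measure.absolutelyContinuous_of_le key).trans
    (withDensity_absolutelyContinuous _ _)
  have hf : π.rnDeriv ν ≤ᵐ[ν] fun z => h z.2 := by
    refine ae_le_of_forall_setLIntegral_le_of_sigmaFinite (Measure.measurable_rnDeriv _ _) ?_
    intro A hA _
    rw [Measure.setLIntegral_rnDeriv hac, ← withDensity_apply _ hA]
    exact key A
  have hint : ∫⁻ z, π.rnDeriv ν z ∂ν = 1 := by
    rw [Measure.lintegral_rnDeriv hac, measure_univ]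
  have hI : ∫⁻ y, h y ∂μ₂ ≤ n := by
    simp only [h]
    rw [lintegral_finsetSum _ fun a _ => measurable_const.indicator (measurableSet_singleton a)]
    calc _ ≤ ∑ a ∈ s, (1 : ℝ≥0∞) := by
          refine Finset.sum_le_sum fun a _ => ?_
          rw [lintegral_indicator (measurableSet_singleton a), setLIntegral_const]
          exact ENNReal.inv_mul_le_one _
      _ ≤ n := by
          simpa using hsn
  have hJ : ∫⁻ y, h y ^ (q - 1) ∂μ₂ ≤ (n : ℝ≥0∞) ^ (q - 1) := by
    have := eLpNorm'_le_eLpNorm'_of_exponent_le (μ := μ₂) (f := h) (p := q - 1) (q := 1)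
      (by linarith) (by linarith) hm.aestronglyMeasurable
    simp only [eLpNorm', enorm_eq_self, ENNReal.rpow_one, div_one] at this
    have h3 := ENNReal.rpow_le_rpow (this.trans hI) (by linarith : 0 ≤ q - 1)
    rwa [← ENNReal.rpow_mul, one_div, inv_mul_cancel₀ (by linarith), ENNReal.rpow_one] at h3
  have hK : ∫⁻ z, π.rnDeriv ν z ^ q ∂ν ≤ (n : ℝ≥0∞) ^ (q - 1) := by
    calc _ ≤ ∫⁻ z, π.rnDeriv ν z * h z.2 ^ (q - 1) ∂ν := by
          refine lintegral_mono_ae ?_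
          filter_upwards [hf] with z hz
          have : π.rnDeriv ν z ^ q = π.rnDeriv ν z * π.rnDeriv ν z ^ (q - 1) := by
            conv_lhs => rw [show q = 1 + (q - 1) by ring]
            rw [ENNReal.rpow_add_of_nonneg _ _ zero_le_one (by linarith), ENNReal.rpow_one]
          rw [this]
          gcongr
      _ = ∫⁻ z, h z.2 ^ (q - 1) ∂π :=
          lintegral_rnDeriv_mul hac ((hm.comp measurable_snd).pow_const _).aemeasurable
      _ = ∫⁻ y, h y ^ (q - 1) ∂μ₂ := by
          rw [← h2, lintegral_map (hm.pow_const _) measurable_snd]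
      _ ≤ _ := hJ
  rw [tsallisDiv, if_pos hac, hint, ENNReal.ofReal_div_of_pos (by linarith),
    ENNReal.ofReal_sub ((n : ℝ) ^ (q - 1)) zero_le_one, ENNReal.ofReal_one,
    ← ENNReal.ofReal_rpow_of_nonneg (Nat.cast_nonneg n) (by linarith), ENNReal.ofReal_natCast]
  gcongr

end
end

section
/- Let X₁ and X₂ be Polish metric spaces, μ and ν probability measures on X₁, and K: X₁ → 𝒫(X₂) a Markov kernel. Then for every q > 1, the Tsallis relative entropy satisfies the data processing inequality D_q(μK, νK) ≤ D_q(μ, ν), where μK denotes the second marginal of μ ⊗ K. -/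
open MeasureTheory Filter Topology
open scoped ENNReal Classical

noncomputable section

lemma tsallis_lintegral_trunc {Z Y : Type*} [MeasurableSpace Z] [MeasurableSpace Y]
    (Q P : Measure Z) [IsFiniteMeasure Q] [IsFiniteMeasure P] (h : Q ≪ P)
    (φ : Z → Y) (hφ : Measurable φ) (q : ℝ) (hq : 1 < q) (n : ℕ) :
    ∫⁻ y, (min ((Q.map φ).rnDeriv (P.map φ) y) n) ^ q ∂(P.map φ)
      ≤ ∫⁻ z, Q.rnDeriv P z ^ q ∂P := by
  have h' : Q.map φ ≪ P.map φ := h.map hφ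
  set g := (Q.map φ).rnDeriv (P.map φ) with hg
  have hgm : Measurable g := Measure.measurable_rnDeriv _ _
  set t : Y → ℝ≥0∞ := fun y => min (g y) n with ht
  have htm : Measurable t := hgm.min measurable_const
  have hq0 : 0 < q := by linarith
  have hpq : q.HolderConjugate (q / (q - 1)) := Real.HolderConjugate.conjExponent hq
  set A := ∫⁻ y, t y ^ q ∂(P.map φ) with hA
  set B := ∫⁻ z, Q.rnDeriv P z ^ q ∂P with hB
  have hAtop : A ≠ ⊤ := by
    have : A ≤ ∫⁻ y, (n : ℝ≥0∞) ^ q ∂(P.map φ) :=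
      lintegral_mono fun y => ENNReal.rpow_le_rpow (min_le_right _ _) hq0.le
    refine ne_top_of_le_ne_top ?_ this
    rw [lintegral_const]
    exact ENNReal.mul_ne_top (ENNReal.rpow_ne_top_of_nonneg hq0.le (ENNReal.natCast_ne_top n))
      (measure_ne_top _ _)
  have h1 : A ≤ ∫⁻ y, g y * t y ^ (q - 1) ∂(P.map φ) := by
    refine lintegral_mono fun y => ?_
    have e : t y ^ q = t y * t y ^ (q - 1) := by
      conv_rhs => rw [← ENNReal.rpow_one (t y), ← ENNReal.rpow_mul, one_mul]
      rw [← ENNReal.rpow_add_of_nonneg _ _ zero_le_one (by linarith)]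
      congr 1; ring
    change t y ^ q ≤ _
    rw [e]
    gcongr
    exact min_le_left _ _
  have h2 : ∫⁻ y, g y * t y ^ (q - 1) ∂(P.map φ) = ∫⁻ z, Q.rnDeriv P z * t (φ z) ^ (q - 1) ∂P := by
    rw [lintegral_rnDeriv_mul h' (htm.pow_const _).aemeasurable,
      lintegral_map (htm.pow_const _) hφ]
    exact (lintegral_rnDeriv_mul h ((htm.comp hφ).pow_const _).aemeasurable).symm
  have h3 : ∫⁻ z, Q.rnDeriv P z * t (φ z) ^ (q - 1) ∂P
      ≤ B ^ (1 / q) * A ^ (1 / (q / (q - 1))) := by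
    refine (ENNReal.lintegral_mul_le_Lp_mul_Lq P hpq
      (Measure.measurable_rnDeriv _ _).aemeasurable
      ((htm.comp hφ).pow_const (q - 1)).aemeasurable).trans (le_of_eq ?_)
    congr 2
    rw [hA, lintegral_map (htm.pow_const _) hφ]
    refine lintegral_congr fun z => ?_
    rw [← ENNReal.rpow_mul]
    congr 1
    field_simp [(by linarith : q - 1 ≠ 0)]
  have h4 := (h1.trans h2.le).trans h3
  by_cases hA0 : A = 0
  · rw [hA0]; exact zero_le
  have e : A = A ^ (1 / q) * A ^ (1 / (q / (q - 1))) := by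
    rw [← ENNReal.rpow_add _ _ hA0 hAtop]
    have : 1 / q + 1 / (q / (q - 1)) = 1 := by
      have := sub_pos.2 hq
      field_simp
      ring
    rw [this, ENNReal.rpow_one]
  have hA1 : A ^ (1 / (q / (q - 1))) ≠ 0 := by
    simp [ENNReal.rpow_eq_zero_iff, hA0, hAtop]
  have hA2 : A ^ (1 / (q / (q - 1))) ≠ ⊤ := by
    simp [ENNReal.rpow_eq_top_iff, hA0, hAtop]
  have h5 : A ^ (1 / q) * A ^ (1 / (q / (q - 1))) ≤ B ^ (1 / q) * A ^ (1 / (q / (q - 1))) :=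
    e.symm.le.trans h4
  have h6 : A ^ (1 / q) ≤ B ^ (1 / q) := (ENNReal.mul_le_mul_iff_left hA1 hA2).1 h5
  exact (ENNReal.rpow_le_rpow_iff (by positivity)).1 h6

lemma tsallis_lintegral_map {Z Y : Type*} [MeasurableSpace Z] [MeasurableSpace Y]
    (Q P : Measure Z) [IsFiniteMeasure Q] [IsFiniteMeasure P] (h : Q ≪ P)
    (φ : Z → Y) (hφ : Measurable φ) (q : ℝ) (hq : 1 < q) :
    ∫⁻ y, ((Q.map φ).rnDeriv (P.map φ) y) ^ q ∂(P.map φ)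
      ≤ ∫⁻ z, Q.rnDeriv P z ^ q ∂P := by
  have hgm := Measure.measurable_rnDeriv (Q.map φ) (P.map φ)
  have hq0 : 0 ≤ q := by linarith
  have key : ∫⁻ y, ((Q.map φ).rnDeriv (P.map φ) y) ^ q ∂(P.map φ)
      ≤ ∫⁻ y, ⨆ n : ℕ, (min ((Q.map φ).rnDeriv (P.map φ) y) n) ^ q ∂(P.map φ) := by
    refine lintegral_mono_ae ?_
    filter_upwards [Measure.rnDeriv_ne_top (Q.map φ) (P.map φ)] with y hy
    obtain ⟨n, hn⟩ := ENNReal.exists_nat_gt hy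
    refine le_trans ?_ (le_iSup _ n)
    rw [min_eq_left hn.le]
  refine key.trans ?_
  rw [lintegral_iSup (fun n => (hgm.min measurable_const).pow_const q)]
  · exact iSup_le fun n => tsallis_lintegral_trunc Q P h φ hφ q hq n
  · intro n m hnm y
    refine ENNReal.rpow_le_rpow (min_le_min_left _ ?_) hq0
    exact_mod_cast hnm

/-- Data processing inequality for the Tsallis relative entropy: pushing `μ` and `ν` through
a Markov kernel (taking the second marginal of `μ ⊗ K`) does not increase `D_q`. -/
theorem tsallisDiv_data_processing
    {X₁ : Type*} [MetricSpace X₁] [CompleteSpace X₁] [TopologicalSpace.SeparableSpace X₁]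
    [MeasurableSpace X₁] [BorelSpace X₁]
    {X₂ : Type*} [MetricSpace X₂] [CompleteSpace X₂] [TopologicalSpace.SeparableSpace X₂]
    [MeasurableSpace X₂] [BorelSpace X₂]
    (μ ν : Measure X₁) [IsProbabilityMeasure μ] [IsProbabilityMeasure ν]
    (κ : ProbabilityTheory.Kernel X₁ X₂) [ProbabilityTheory.IsMarkovKernel κ]
    (q : ℝ) (hq : 1 < q) :
    tsallisDiv q ((μ.compProd κ).map Prod.snd) ((ν.compProd κ).map Prod.snd)
      ≤ tsallisDiv q μ ν := by
  unfold tsallisDiv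
  by_cases hac : μ ≪ ν
  swap
  · rw [if_neg hac]; exact le_top
  have hac2 : μ.compProd κ ≪ ν.compProd κ := hac.compProd_left κ
  have hac3 := hac2.map measurable_snd
  haveI : IsProbabilityMeasure ((μ.compProd κ).map Prod.snd) :=
    Measure.isProbabilityMeasure_map measurable_snd.aemeasurable
  rw [if_pos hac, if_pos hac3, Measure.lintegral_rnDeriv hac, Measure.lintegral_rnDeriv hac3,
    measure_univ, measure_univ]
  gcongr
  refine (tsallis_lintegral_map _ _ hac2 Prod.snd measurable_snd q hq).trans (le_of_eq ?_)
  have hm : Measurable fun x => μ.rnDeriv ν x ^ q := (Measure.measurable_rnDeriv _ _).pow_const q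
  calc _ = ∫⁻ z, μ.rnDeriv ν z.1 ^ q ∂(ν.compProd κ) := by
        refine lintegral_congr_ae ?_
        filter_upwards [ProbabilityTheory.rnDeriv_measure_compProd_left μ ν κ] with z hz
        rw [hz]
    _ = ∫⁻ x, μ.rnDeriv ν x ^ q ∂((ν.compProd κ).map Prod.fst) :=
        (lintegral_map hm measurable_fst).symm
    _ = _ := by
        rw [← Measure.fst, Measure.fst_compProd]

end
end

section
/- Let X₁ and X₂ be Polish metric spaces, μ and ν probability measures on X₁ with μ ≪ ν, and K: X₁ → 𝒫(X₂) a Markov kernel. Then for every q > 1: D_q(μ ⊗ K, ν ⊗ K) = D_q(μ, ν). -/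
open MeasureTheory Filter Topology
open scoped ENNReal Classical

noncomputable section

/-- Tensorizing with the same Markov kernel preserves the Tsallis relative entropy. -/
theorem tsallisDiv_compProd_same_kernel
    {X₁ : Type*} [MetricSpace X₁] [CompleteSpace X₁] [TopologicalSpace.SeparableSpace X₁]
    [MeasurableSpace X₁] [BorelSpace X₁]
    {X₂ : Type*} [MetricSpace X₂] [CompleteSpace X₂] [TopologicalSpace.SeparableSpace X₂]
    [MeasurableSpace X₂] [BorelSpace X₂]
    (μ ν : Measure X₁) [IsProbabilityMeasure μ] [IsProbabilityMeasure ν]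
    (hμν : μ ≪ ν)
    (κ : ProbabilityTheory.Kernel X₁ X₂) [ProbabilityTheory.IsMarkovKernel κ]
    (q : ℝ) (hq : 1 < q) :
    tsallisDiv q (μ.compProd κ) (ν.compProd κ) = tsallisDiv q μ ν := by
  have hrn := ProbabilityTheory.rnDeriv_measure_compProd_left μ ν κ
  have hac : μ.compProd κ ≪ ν.compProd κ := hμν.compProd_left κ
  have key : ∀ f : ℝ≥0∞ → ℝ≥0∞, Measurable f →
      ∫⁻ p, f ((μ.compProd κ).rnDeriv (ν.compProd κ) p) ∂(ν.compProd κ)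
        = ∫⁻ x, f (μ.rnDeriv ν x) ∂ν := by
    intro f hf
    have h1 : ∫⁻ p, f ((μ.compProd κ).rnDeriv (ν.compProd κ) p) ∂(ν.compProd κ)
        = ∫⁻ p, f (μ.rnDeriv ν p.1) ∂(ν.compProd κ) := by
      apply lintegral_congr_ae
      filter_upwards [hrn] with p hp
      rw [hp]
    rw [h1, Measure.lintegral_compProd
      (f := fun p : X₁ × X₂ => f (μ.rnDeriv ν p.1))
      (hf.comp ((Measure.measurable_rnDeriv μ ν).comp measurable_fst))]
    simp
  have k1 := key (fun y => y ^ q) (by fun_prop)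
  have k2 := key (fun y => y) measurable_id
  unfold tsallisDiv
  rw [if_pos hac, if_pos hμν, k1, k2]

end
end

section
/- Let X₁ and X₂ be Polish metric spaces, μ and ν probability measures on X₁ with μ ≪ ν, and K₁, K₂: X₁ → 𝒫(X₂) Markov kernels such that μ ⊗ K₁ ≪ ν ⊗ K₂. Then for every q > 1: D_q(μ ⊗ K₁, ν ⊗ K₂) ≥ D_q(μ, ν). -/
open MeasureTheory Filter Topology
open scoped ENNReal Classical

noncomputable section

/-- Tensorizing with (possibly different) Markov kernels does not decrease the Tsallis
relative entropy. -/
theorem tsallisDiv_le_compProd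
    {X₁ : Type*} [MetricSpace X₁] [CompleteSpace X₁] [TopologicalSpace.SeparableSpace X₁]
    [MeasurableSpace X₁] [BorelSpace X₁]
    {X₂ : Type*} [MetricSpace X₂] [CompleteSpace X₂] [TopologicalSpace.SeparableSpace X₂]
    [MeasurableSpace X₂] [BorelSpace X₂]
    (μ ν : Measure X₁) [IsProbabilityMeasure μ] [IsProbabilityMeasure ν]
    (hμν : μ ≪ ν)
    (κ₁ κ₂ : ProbabilityTheory.Kernel X₁ X₂)
    [ProbabilityTheory.IsMarkovKernel κ₁] [ProbabilityTheory.IsMarkovKernel κ₂]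
    (hac : μ.compProd κ₁ ≪ ν.compProd κ₂)
    (q : ℝ) (hq : 1 < q) :
    tsallisDiv q μ ν ≤ tsallisDiv q (μ.compProd κ₁) (ν.compProd κ₂) := by
  have hg : Measurable (fun x => ∫⁻ y, (μ.compProd κ₁).rnDeriv (ν.compProd κ₂) (x, y) ∂(κ₂ x)) :=
    (Measure.measurable_rnDeriv _ _).lintegral_kernel_prod_right'
  have hwd : μ = ν.withDensity
      (fun x => ∫⁻ y, (μ.compProd κ₁).rnDeriv (ν.compProd κ₂) (x, y) ∂(κ₂ x)) := by
    ext A hA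
    rw [withDensity_apply _ hA]
    have h1 : (μ.compProd κ₁) (A ×ˢ Set.univ) = μ A := by
      rw [Measure.compProd_apply_prod hA MeasurableSet.univ]
      simp
    rw [← h1, ← Measure.setLIntegral_rnDeriv hac,
      Measure.setLIntegral_compProd (Measure.measurable_rnDeriv _ _) hA MeasurableSet.univ]
    simp
  have hae : μ.rnDeriv ν =ᵐ[ν]
      (fun x => ∫⁻ y, (μ.compProd κ₁).rnDeriv (ν.compProd κ₂) (x, y) ∂(κ₂ x)) := by
    have h := Measure.rnDeriv_withDensity ν hg
    rwa [← hwd] at h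
  unfold tsallisDiv
  rw [if_pos hμν, if_pos hac, Measure.lintegral_rnDeriv hμν, Measure.lintegral_rnDeriv hac]
  simp only [measure_univ]
  refine ENNReal.div_le_div_right (tsub_le_tsub_right ?_ _) _
  rw [Measure.lintegral_compProd ((Measure.measurable_rnDeriv _ _).pow_const q)]
  apply lintegral_mono_ae
  filter_upwards [hae] with x hx
  rw [hx]
  have hm : Measurable (fun y => (μ.compProd κ₁).rnDeriv (ν.compProd κ₂) (x, y)) :=
    (Measure.measurable_rnDeriv _ _).comp measurable_prodMk_left
  have hh := ENNReal.lintegral_mul_le_Lp_mul_Lq (κ₂ x)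
    (Real.HolderConjugate.conjExponent hq) hm.aemeasurable
    (g := fun _ => 1) aemeasurable_const
  simp only [Pi.mul_apply, mul_one, ENNReal.one_rpow, lintegral_const, measure_univ] at hh
  have h2 := ENNReal.rpow_le_rpow hh (by linarith : 0 ≤ q)
  rwa [← ENNReal.rpow_mul, one_div, inv_mul_cancel₀ (by linarith), ENNReal.rpow_one] at h2

end
end

section
/- Let X₁ and X₂ be Polish metric spaces, p ∈ [1,∞), and μᵢ, μ̃ᵢ ∈ 𝒫_p(Xᵢ) (i = 1,2). Then for every coupling π ∈ Π(μ₁,μ₂) and every q > 1, there exists a coupling π̃ ∈ Π(μ̃₁,μ̃₂) (a shadow of π) such that W_p(π, π̃)^p = W_p(μ₁, μ̃₁)^p + W_p(μ₂, μ̃₂)^p and D_q(π̃, μ̃₁⊗μ̃₂) ≤ D_q(π, μ₁⊗μ₂). -/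
open MeasureTheory Filter Topology
open scoped ENNReal Classical

noncomputable section

/-- `p`-Wasserstein distance. -/
def Wp {X : Type*} [MeasurableSpace X] [PseudoEMetricSpace X] (p : ℝ)
    (μ ν : Measure X) : ℝ≥0∞ :=
  ⨅ (γ : Measure (X × X)) (_ : IsCoupling γ μ ν),
    (∫⁻ z, edist z.1 z.2 ^ p ∂γ) ^ (1 / p)

/-- `p`-Wasserstein distance between measures on a product space, with respect to the metric
`d((x₁,x₂),(y₁,y₂)) = (d₁(x₁,y₁)^p + d₂(x₂,y₂)^p)^{1/p}`. -/
def WpProd {X₁ X₂ : Type*} [MeasurableSpace X₁] [MeasurableSpace X₂]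
    [PseudoEMetricSpace X₁] [PseudoEMetricSpace X₂] (p : ℝ)
    (π π' : Measure (X₁ × X₂)) : ℝ≥0∞ :=
  ⨅ (γ : Measure ((X₁ × X₂) × (X₁ × X₂))) (_ : IsCoupling γ π π'),
    (∫⁻ z, (edist z.1.1 z.2.1 ^ p + edist z.1.2 z.2.2 ^ p) ∂γ) ^ (1 / p)

/-- `μ` has a finite `p`-th moment. -/
def HasFiniteMoment {X : Type*} [MeasurableSpace X] [PseudoEMetricSpace X] (p : ℝ)
    (μ : Measure X) : Prop :=
  ∃ x₀ : X, ∫⁻ x, edist x x₀ ^ p ∂μ ≠ ⊤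

/-- Condition `(A_{L,C})` on the cost function `c` relative to the marginals `μ₁, μ₂`. -/
def CondA {X₁ X₂ : Type*} [MeasurableSpace X₁] [MeasurableSpace X₂]
    [PseudoEMetricSpace X₁] [PseudoEMetricSpace X₂]
    (p L C : ℝ) (c : X₁ × X₂ → ℝ) (μ₁ : Measure X₁) (μ₂ : Measure X₂) : Prop :=
  ∀ (ν₁ : Measure X₁) (ν₂ : Measure X₂),
    IsProbabilityMeasure ν₁ → IsProbabilityMeasure ν₂ →
    HasFiniteMoment p ν₁ → HasFiniteMoment p ν₂ →
    Wp p ν₁ μ₁ ≤ ENNReal.ofReal C → Wp p ν₂ μ₂ ≤ ENNReal.ofReal C →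
    ∀ π : Measure (X₁ × X₂), IsCoupling π μ₁ μ₂ →
    ∀ π' : Measure (X₁ × X₂), IsCoupling π' ν₁ ν₂ →
      |(∫ z, c z ∂π) - ∫ z, c z ∂π'| ≤ L * (WpProd p π π').toReal

open ProbabilityTheory

/-- Monotone limit of truncations. -/
lemma shadow_iSup_min (a : ℝ≥0∞) : ⨆ n : ℕ, min a (n : ℝ≥0∞) = a := by
  rw [← inf_iSup_eq (a := a) (f := fun n : ℕ => (n : ℝ≥0∞)), ENNReal.iSup_natCast]
  simp

/-- Data processing for the `q`-power integral of the density. -/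
lemma shadow_dpi {X Y : Type*} [MeasurableSpace X] [MeasurableSpace Y]
    (π ν : Measure X) [IsProbabilityMeasure π] [IsProbabilityMeasure ν] (hπν : π ≪ ν)
    (K : Kernel X Y) [IsMarkovKernel K] (q : ℝ) (hq : 1 < q) :
    ∫⁻ y, (K ∘ₘ π).rnDeriv (K ∘ₘ ν) y ^ q ∂(K ∘ₘ ν) ≤ ∫⁻ x, π.rnDeriv ν x ^ q ∂ν := by
  have hac : (K ∘ₘ π) ≪ (K ∘ₘ ν) := hπν.comp_right K
  set f := π.rnDeriv ν with hf
  set g := (K ∘ₘ π).rnDeriv (K ∘ₘ ν) with hg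
  have hfm : Measurable f := Measure.measurable_rnDeriv _ _
  have hgm : Measurable g := Measure.measurable_rnDeriv _ _
  have hq0 : 0 < q := by linarith
  have hq1 : 0 < q - 1 := by linarith
  have key : ∀ n : ℕ, ∫⁻ y, (min (g y) n) ^ q ∂(K ∘ₘ ν) ≤ ∫⁻ x, f x ^ q ∂ν := by
    intro n
    set h : Y → ℝ≥0∞ := fun y => min (g y) n with hh
    have hhm : Measurable h := hgm.min measurable_const
    have hfin : ∫⁻ y, h y ^ q ∂(K ∘ₘ ν) ≠ ⊤ := by
      apply ne_of_lt
      calc ∫⁻ y, h y ^ q ∂(K ∘ₘ ν) ≤ ∫⁻ _, (n : ℝ≥0∞) ^ q ∂(K ∘ₘ ν) := by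
            apply lintegral_mono
            intro y
            exact ENNReal.rpow_le_rpow (min_le_right _ _) hq0.le
        _ < ⊤ := by
            rw [lintegral_const, measure_univ, mul_one]
            exact ENNReal.rpow_lt_top_of_nonneg hq0.le (ENNReal.natCast_ne_top n)
    have hconj : q.HolderConjugate (q / (q - 1)) := Real.HolderConjugate.conjExponent hq
    have h1 : ∫⁻ y, h y ^ q ∂(K ∘ₘ ν) ≤
        (∫⁻ x, f x ^ q ∂ν) ^ (1 / q) * (∫⁻ y, h y ^ q ∂(K ∘ₘ ν)) ^ (1 / (q / (q - 1))) := by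
      calc ∫⁻ y, h y ^ q ∂(K ∘ₘ ν) ≤ ∫⁻ y, g y * h y ^ (q - 1) ∂(K ∘ₘ ν) := by
            apply lintegral_mono
            intro y
            have : h y ^ q = h y * h y ^ (q - 1) := by
              have e : q = 1 + (q - 1) := by ring
              conv_lhs => rw [e, ENNReal.rpow_add_of_nonneg _ _ zero_le_one hq1.le,
                ENNReal.rpow_one]
            simp only [this]
            gcongr
            exact min_le_left _ _
        _ = ∫⁻ y, h y ^ (q - 1) ∂(K ∘ₘ π) := by
            rw [hg, lintegral_rnDeriv_mul hac (hhm.pow_const _).aemeasurable]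
        _ = ∫⁻ x, ∫⁻ y, h y ^ (q - 1) ∂(K x) ∂π := by
            rw [Measure.lintegral_bind K.measurable.aemeasurable (hhm.pow_const _).aemeasurable]
        _ = ∫⁻ x, f x * ∫⁻ y, h y ^ (q - 1) ∂(K x) ∂ν := by
            rw [hf, lintegral_rnDeriv_mul hπν]
            exact ((hhm.pow_const _).lintegral_kernel).aemeasurable
        _ = ∫⁻ x, ∫⁻ y, f x * h y ^ (q - 1) ∂(K x) ∂ν := by
            congr with x
            rw [lintegral_const_mul _ (hhm.pow_const _)]
        _ = ∫⁻ z, ((fun z : X × Y => f z.1) * (fun z : X × Y => h z.2 ^ (q - 1))) z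
              ∂(ν ⊗ₘ K) := by
            rw [Measure.lintegral_compProd]
            · rfl
            · exact (hfm.comp measurable_fst).mul ((hhm.comp measurable_snd).pow_const _)
        _ ≤ (∫⁻ z, f z.1 ^ q ∂(ν ⊗ₘ K)) ^ (1 / q) *
            (∫⁻ z, (h z.2 ^ (q - 1)) ^ (q / (q - 1)) ∂(ν ⊗ₘ K)) ^ (1 / (q / (q - 1))) := by
            apply ENNReal.lintegral_mul_le_Lp_mul_Lq _ hconj
            · exact (hfm.comp measurable_fst).aemeasurable
            · exact ((hhm.comp measurable_snd).pow_const _).aemeasurable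
        _ = _ := by
            congr 2
            · rw [Measure.lintegral_compProd (f := fun z : X × Y => f z.1 ^ q)
                ((hfm.comp measurable_fst).pow_const _)]
              simp
            · rw [Measure.lintegral_compProd
                (f := fun z : X × Y => (h z.2 ^ (q - 1)) ^ (q / (q - 1)))
                (((hhm.comp measurable_snd).pow_const _).pow_const _),
                Measure.lintegral_bind K.measurable.aemeasurable (hhm.pow_const _).aemeasurable]
              congr with x
              congr with y
              rw [← ENNReal.rpow_mul]
              congr 1
              field_simp
    set A := ∫⁻ y, h y ^ q ∂(K ∘ₘ ν)
    set B := ∫⁻ x, f x ^ q ∂ν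
    by_cases hA : A = 0
    · rw [hA]; exact zero_le
    have h2 : A ^ (1 / q) * A ^ (1 / (q / (q - 1))) ≤ B ^ (1 / q) * A ^ (1 / (q / (q - 1))) := by
      rw [← ENNReal.rpow_add _ _ hA hfin]
      have : 1 / q + 1 / (q / (q - 1)) = 1 := by field_simp; ring
      rw [this, ENNReal.rpow_one]
      exact h1
    have h3 : A ^ (1 / q) ≤ B ^ (1 / q) := by
      refine (ENNReal.mul_le_mul_iff_left ?_ ?_).1 h2
      · simp [ENNReal.rpow_eq_zero_iff, hA, hfin]
      · apply ENNReal.rpow_ne_top_of_nonneg _ hfin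
        positivity
    exact (ENNReal.rpow_le_rpow_iff (by positivity)).1 h3
  have hmono : ∫⁻ y, g y ^ q ∂(K ∘ₘ ν) = ⨆ n : ℕ, ∫⁻ y, (min (g y) n) ^ q ∂(K ∘ₘ ν) := by
    rw [← lintegral_iSup]
    · congr with y
      conv_lhs => rw [← shadow_iSup_min (g y)]
      exact (ENNReal.orderIsoRpow q hq0).map_iSup _
    · intro n
      exact (hgm.min measurable_const).pow_const _
    · intro m n hmn y
      apply ENNReal.rpow_le_rpow _ hq0.le
      exact min_le_min_left _ (by exact_mod_cast hmn)
  rw [hmono]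
  exact iSup_le key

lemma shadow_tsallis {X Y : Type*} [MeasurableSpace X] [MeasurableSpace Y]
    (π ν : Measure X) [IsProbabilityMeasure π] [IsProbabilityMeasure ν]
    (K : Kernel X Y) [IsMarkovKernel K] (q : ℝ) (hq : 1 < q) :
    tsallisDiv q (K ∘ₘ π) (K ∘ₘ ν) ≤ tsallisDiv q π ν := by
  unfold tsallisDiv
  by_cases h : π ≪ ν
  · rw [if_pos h, if_pos (h.comp_right K)]
    rw [Measure.lintegral_rnDeriv h, Measure.lintegral_rnDeriv (h.comp_right K), measure_univ,
      measure_univ]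
    gcongr
    exact shadow_dpi π ν h K q hq
  · rw [if_neg h]; exact le_top

/-- Existence of optimal couplings. -/
lemma shadow_opt {X : Type*} [MetricSpace X] [CompleteSpace X]
    [TopologicalSpace.SeparableSpace X] [MeasurableSpace X] [BorelSpace X]
    (p : ℝ) (hp : 1 ≤ p) (μ ν : Measure X) [IsProbabilityMeasure μ] [IsProbabilityMeasure ν] :
    ∃ γ : Measure (X × X), IsCoupling γ μ ν ∧ ∫⁻ z, edist z.1 z.2 ^ p ∂γ = Wp p μ ν ^ p := by
  haveI : SecondCountableTopology X := UniformSpace.secondCountable_of_separable X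
  have hp0 : 0 < p := by linarith
  let S : Set (ProbabilityMeasure (X × X)) := {γ | IsCoupling (γ : Measure (X × X)) μ ν}
  have hne : S.Nonempty := by
    refine ⟨⟨μ.prod ν, inferInstance⟩, ?_⟩
    constructor
    · simp
    · simp
  have hclosed : IsClosed S := by
    have e : S = (fun γ : ProbabilityMeasure (X × X) => γ.map
          (continuous_fst.measurable.aemeasurable)) ⁻¹' {(⟨μ, inferInstance⟩ : ProbabilityMeasure X)}
        ∩ (fun γ : ProbabilityMeasure (X × X) => γ.map
          (continuous_snd.measurable.aemeasurable)) ⁻¹'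
            {(⟨ν, inferInstance⟩ : ProbabilityMeasure X)} := by
      ext γ
      constructor
      · intro h
        exact ⟨Subtype.ext h.1, Subtype.ext h.2⟩
      · intro h
        exact ⟨congrArg Subtype.val h.1, congrArg Subtype.val h.2⟩
    rw [e]
    exact (isClosed_singleton.preimage (ProbabilityMeasure.continuous_map continuous_fst)).inter
      (isClosed_singleton.preimage (ProbabilityMeasure.continuous_map continuous_snd))
  have htight : IsTightMeasureSet {((γ : ProbabilityMeasure (X × X)) : Measure (X × X)) | γ ∈ S} := by
    apply IsTightMeasureSet.prodMk
    · refine (isTightMeasureSet_singleton (μ := μ)).subset ?_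
      rintro _ ⟨_, ⟨γ, hγ, rfl⟩, rfl⟩
      exact hγ.1
    · refine (isTightMeasureSet_singleton (μ := ν)).subset ?_
      rintro _ ⟨_, ⟨γ, hγ, rfl⟩, rfl⟩
      exact hγ.2
  have hcomp : IsCompact S := by
    have := isCompact_closure_of_isTightMeasureSet htight
    rwa [hclosed.closure_eq] at this
  have hcont : Continuous (fun z : X × X => nndist z.1 z.2 ^ p) :=
    (NNReal.continuous_rpow_const hp0.le).comp continuous_nndist
  let φ : ℕ → BoundedContinuousFunction (X × X) NNReal := fun n =>
    BoundedContinuousFunction.mkOfBound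
      ⟨fun z => min (nndist z.1 z.2 ^ p) n, hcont.min continuous_const⟩ n (by
        intro x y
        simp only [ContinuousMap.coe_mk]
        rw [NNReal.dist_eq, abs_sub_le_iff]
        have h1 : ((min (nndist x.1 x.2 ^ p) n : NNReal) : ℝ) ≤ n := by
          exact_mod_cast min_le_right _ _
        have h2 : ((min (nndist y.1 y.2 ^ p) n : NNReal) : ℝ) ≤ n := by
          exact_mod_cast min_le_right _ _
        have h3 := NNReal.coe_nonneg (min (nndist x.1 x.2 ^ p) n)
        have h4 := NNReal.coe_nonneg (min (nndist y.1 y.2 ^ p) n)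
        constructor <;> linarith)
  have hrep : ∀ γ : ProbabilityMeasure (X × X),
      ∫⁻ z, edist z.1 z.2 ^ p ∂(γ : Measure (X × X)) =
        ⨆ n : ℕ, ∫⁻ z, φ n z ∂(γ : Measure (X × X)) := by
    intro γ
    rw [← lintegral_iSup]
    · congr with z
      rw [← shadow_iSup_min (edist z.1 z.2 ^ p)]
      congr with n
      simp only [φ, BoundedContinuousFunction.mkOfBound_coe, ContinuousMap.coe_mk]
      rw [edist_nndist, ← ENNReal.coe_rpow_of_nonneg _ hp0.le]
      push_cast
      rfl
    · intro n
      exact (ENNReal.continuous_coe.comp (φ n).continuous).measurable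
    · intro m n hmn z
      simp only [φ, BoundedContinuousFunction.mkOfBound_coe, ContinuousMap.coe_mk]
      gcongr
  have hlsc : LowerSemicontinuous (fun γ : ProbabilityMeasure (X × X) =>
      ∫⁻ z, edist z.1 z.2 ^ p ∂(γ : Measure (X × X))) := by
    simp_rw [hrep]
    apply lowerSemicontinuous_iSup
    intro n
    apply Continuous.lowerSemicontinuous
    rw [continuous_iff_continuousAt]
    intro γ
    exact (ProbabilityMeasure.tendsto_iff_forall_lintegral_tendsto.1 tendsto_id) (φ n)
  obtain ⟨γ, hγS, hγ⟩ := LowerSemicontinuousOn.exists_isMinOn hne hcomp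
    (hlsc.lowerSemicontinuousOn S)
  refine ⟨γ, hγS, ?_⟩
  have hW : Wp p μ ν = (∫⁻ z, edist z.1 z.2 ^ p ∂(γ : Measure (X × X))) ^ (1 / p) := by
    apply le_antisymm
    · exact iInf₂_le (γ : Measure (X × X)) hγS
    · refine le_iInf₂ fun η hη => ?_
      have : IsProbabilityMeasure η := by
        constructor
        have := hη.1
        have h2 : (η.map Prod.fst) Set.univ = 1 := by rw [this]; simp
        rwa [Measure.map_apply measurable_fst MeasurableSet.univ] at h2
      apply ENNReal.rpow_le_rpow _ (by positivity)
      exact hγ (show (⟨η, this⟩ : ProbabilityMeasure (X × X)) ∈ S from hη)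
  rw [hW, ← ENNReal.rpow_mul]
  have : 1 / p * p = 1 := by field_simp
  rw [this, ENNReal.rpow_one]

/-- Disintegration of an optimal coupling. -/
lemma shadow_kernel {X : Type*} [MetricSpace X] [CompleteSpace X]
    [TopologicalSpace.SeparableSpace X] [MeasurableSpace X] [BorelSpace X]
    (p : ℝ) (hp : 1 ≤ p) (μ ν : Measure X) [IsProbabilityMeasure μ] [IsProbabilityMeasure ν] :
    ∃ κ : Kernel X X, IsMarkovKernel κ ∧ κ ∘ₘ μ = ν ∧
      ∫⁻ x, ∫⁻ y, edist x y ^ p ∂(κ x) ∂μ = Wp p μ ν ^ p := by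
  haveI : SecondCountableTopology X := UniformSpace.secondCountable_of_separable X
  obtain ⟨γ, hγ, hc⟩ := shadow_opt p hp μ ν
  have : IsProbabilityMeasure γ := by
    constructor
    have h2 : (γ.map Prod.fst) Set.univ = 1 := by rw [hγ.1]; simp
    rwa [Measure.map_apply measurable_fst MeasurableSet.univ] at h2
  haveI : Nonempty X := μ.nonempty_of_neZero
  have hd := γ.disintegrate γ.condKernel
  have hfst : γ.fst = μ := hγ.1
  rw [hfst] at hd
  refine ⟨γ.condKernel, inferInstance, ?_, ?_⟩
  · rw [← Measure.snd_compProd, hd]; exact hγ.2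
  · rw [← hc]
    conv_rhs => rw [← hd]
    rw [Measure.lintegral_compProd]
    exact (measurable_edist).pow_const _

/-- Existence of a shadow: given marginals `μᵢ` and target marginals `μ̃ᵢ`, every coupling `π`
of the `μᵢ` has a shadow `π̃` coupling the `μ̃ᵢ`, with controlled Wasserstein distance and
Tsallis relative entropy. -/
theorem exists_shadow
    {X₁ : Type*} [MetricSpace X₁] [CompleteSpace X₁] [TopologicalSpace.SeparableSpace X₁]
    [MeasurableSpace X₁] [BorelSpace X₁]
    {X₂ : Type*} [MetricSpace X₂] [CompleteSpace X₂] [TopologicalSpace.SeparableSpace X₂]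
    [MeasurableSpace X₂] [BorelSpace X₂]
    (p : ℝ) (hp : 1 ≤ p)
    (μ₁ μt₁ : Measure X₁) (μ₂ μt₂ : Measure X₂)
    [IsProbabilityMeasure μ₁] [IsProbabilityMeasure μt₁]
    [IsProbabilityMeasure μ₂] [IsProbabilityMeasure μt₂]
    (hm₁ : HasFiniteMoment p μ₁) (hmt₁ : HasFiniteMoment p μt₁)
    (hm₂ : HasFiniteMoment p μ₂) (hmt₂ : HasFiniteMoment p μt₂)
    (π : Measure (X₁ × X₂)) (hπ : IsCoupling π μ₁ μ₂)
    (q : ℝ) (hq : 1 < q) :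
    ∃ πt : Measure (X₁ × X₂), IsCoupling πt μt₁ μt₂ ∧
      WpProd p π πt ^ p = Wp p μ₁ μt₁ ^ p + Wp p μ₂ μt₂ ^ p ∧
      tsallisDiv q πt (μt₁.prod μt₂) ≤ tsallisDiv q π (μ₁.prod μ₂) := by
  haveI : SecondCountableTopology X₁ := UniformSpace.secondCountable_of_separable X₁
  haveI : SecondCountableTopology X₂ := UniformSpace.secondCountable_of_separable X₂
  have hp0 : 0 < p := by linarith
  obtain ⟨κ₁, hκ₁, hb₁, hc₁⟩ := shadow_kernel p hp μ₁ μt₁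
  obtain ⟨κ₂, hκ₂, hb₂, hc₂⟩ := shadow_kernel p hp μ₂ μt₂
  have hπp : IsProbabilityMeasure π := by
    constructor
    have h2 : (π.map Prod.fst) Set.univ = 1 := by rw [hπ.1]; simp
    rwa [Measure.map_apply measurable_fst MeasurableSet.univ] at h2
  have hK : (κ₁ ∥ₖ κ₂) ∘ₘ (μ₁.prod μ₂) = μt₁.prod μt₂ := by
    symm
    apply Measure.prod_eq
    intro s t hs ht
    rw [Measure.bind_apply (hs.prod ht) (Kernel.measurable _).aemeasurable]
    simp_rw [Kernel.parallelComp_apply_prod]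
    rw [lintegral_prod_mul (κ₁.measurable_coe hs).aemeasurable
      (κ₂.measurable_coe ht).aemeasurable, ← hb₁, ← hb₂,
      Measure.bind_apply hs (Kernel.measurable _).aemeasurable,
      Measure.bind_apply ht (Kernel.measurable _).aemeasurable]
  have hcoup : IsCoupling ((κ₁ ∥ₖ κ₂) ∘ₘ π) μt₁ μt₂ := by
    constructor
    · ext s hs
      rw [Measure.map_apply measurable_fst hs, ← Set.prod_univ,
        Measure.bind_apply (hs.prod MeasurableSet.univ) (Kernel.measurable _).aemeasurable]
      simp_rw [Kernel.parallelComp_apply_prod, measure_univ, mul_one]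
      rw [← hb₁, Measure.bind_apply hs (Kernel.measurable _).aemeasurable, ← hπ.1,
        lintegral_map (κ₁.measurable_coe hs) measurable_fst]
    · ext s hs
      rw [Measure.map_apply measurable_snd hs, ← Set.univ_prod,
        Measure.bind_apply (MeasurableSet.univ.prod hs) (Kernel.measurable _).aemeasurable]
      simp_rw [Kernel.parallelComp_apply_prod, measure_univ, one_mul]
      rw [← hb₂, Measure.bind_apply hs (Kernel.measurable _).aemeasurable, ← hπ.2,
        lintegral_map (κ₂.measurable_coe hs) measurable_snd]
  have hm1 : Measurable (fun z : (X₁ × X₂) × (X₁ × X₂) => edist z.1.1 z.2.1 ^ p) := by fun_prop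
  have hm2 : Measurable (fun z : (X₁ × X₂) × (X₁ × X₂) => edist z.1.2 z.2.2 ^ p) := by fun_prop
  have he1 : Measurable (fun z : X₁ × X₁ => edist z.1 z.2 ^ p) := by fun_prop
  have he2 : Measurable (fun z : X₂ × X₂ => edist z.1 z.2 ^ p) := by fun_prop
  have hinv : ∀ a : ℝ≥0∞, (a ^ (1 / p)) ^ p = a := by
    intro a
    rw [← ENNReal.rpow_mul]
    have : 1 / p * p = 1 := by field_simp
    rw [this, ENNReal.rpow_one]
  refine ⟨(κ₁ ∥ₖ κ₂) ∘ₘ π, hcoup, le_antisymm ?_ ?_, ?_⟩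
  · have hle : WpProd p π ((κ₁ ∥ₖ κ₂) ∘ₘ π) ≤
        (∫⁻ z, (edist z.1.1 z.2.1 ^ p + edist z.1.2 z.2.2 ^ p) ∂(π ⊗ₘ (κ₁ ∥ₖ κ₂))) ^ (1 / p) := by
      refine iInf₂_le (π ⊗ₘ (κ₁ ∥ₖ κ₂)) ⟨?_, ?_⟩
      · exact Measure.fst_compProd _ _
      · exact Measure.snd_compProd _ _
    refine (ENNReal.rpow_le_rpow hle hp0.le).trans ?_
    rw [hinv, lintegral_add_left hm1, Measure.lintegral_compProd hm1,
      Measure.lintegral_compProd hm2]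
    apply le_of_eq
    congr 1
    · rw [← hc₁]
      conv_rhs => rw [← hπ.1]
      rw [lintegral_map (he1.lintegral_kernel_prod_right') measurable_fst]
      congr with x
      rw [Kernel.lintegral_parallelComp x (g := fun b => edist x.1 b.1 ^ p) (by fun_prop)]
      simp
    · rw [← hc₂]
      conv_rhs => rw [← hπ.2]
      rw [lintegral_map (he2.lintegral_kernel_prod_right') measurable_snd]
      congr with x
      rw [Kernel.lintegral_parallelComp x (g := fun b => edist x.2 b.2 ^ p) (by fun_prop)]
      simp
  · have hge : (Wp p μ₁ μt₁ ^ p + Wp p μ₂ μt₂ ^ p) ^ (1 / p) ≤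
        WpProd p π ((κ₁ ∥ₖ κ₂) ∘ₘ π) := by
      refine le_iInf₂ fun γ hγ => ?_
      apply ENNReal.rpow_le_rpow _ (by positivity)
      rw [lintegral_add_left hm1]
      gcongr
      · have h : Wp p μ₁ μt₁ ≤ (∫⁻ z, edist z.1 z.2 ^ p
            ∂(γ.map (fun z : (X₁ × X₂) × (X₁ × X₂) => (z.1.1, z.2.1)))) ^ (1 / p) := by
          refine iInf₂_le _ ⟨?_, ?_⟩
          · rw [Measure.map_map measurable_fst (by fun_prop), ← hπ.1, ← hγ.1,
              Measure.map_map measurable_fst measurable_fst]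
            rfl
          · rw [Measure.map_map measurable_snd (by fun_prop), ← hcoup.1, ← hγ.2,
              Measure.map_map measurable_fst measurable_snd]
            rfl
        refine (ENNReal.rpow_le_rpow h hp0.le).trans ?_
        rw [hinv, lintegral_map he1 (by fun_prop)]
      · have h : Wp p μ₂ μt₂ ≤ (∫⁻ z, edist z.1 z.2 ^ p
            ∂(γ.map (fun z : (X₁ × X₂) × (X₁ × X₂) => (z.1.2, z.2.2)))) ^ (1 / p) := by
          refine iInf₂_le _ ⟨?_, ?_⟩
          · rw [Measure.map_map measurable_fst (by fun_prop), ← hπ.2, ← hγ.1,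
              Measure.map_map measurable_snd measurable_fst]
            rfl
          · rw [Measure.map_map measurable_snd (by fun_prop), ← hcoup.2, ← hγ.2,
              Measure.map_map measurable_snd measurable_snd]
            rfl
        refine (ENNReal.rpow_le_rpow h hp0.le).trans ?_
        rw [hinv, lintegral_map he2 (by fun_prop)]
    have := ENNReal.rpow_le_rpow hge hp0.le
    rwa [hinv] at this
  · rw [← hK]
    exact shadow_tsallis π (μ₁.prod μ₂) (κ₁ ∥ₖ κ₂) q hq

end
end

section
/- Let X₁ and X₂ be Polish metric spaces, μ₁, μ₂ probability measures on X₁, X₂, c: X₁ × X₂ → [0,∞) continuous, q > 1, and ε > 0. Then for every coupling π ∈ Π(μ₁,μ₂) and all h₁ ∈ L¹(μ₁), h₂ ∈ L¹(μ₂) such that f_q*((h₁(x) + h₂(y) − c(x,y))/ε) is μ₁⊗μ₂-integrable, the weak duality inequality holds: ∫ c dπ + ε D_q(π, μ₁⊗μ₂) ≥ ∫ h₁ dμ₁ + ∫ h₂ dμ₂ − ε ∫∫ f_q*((h₁(x) + h₂(y) − c(x,y))/ε) dμ₁(x) dμ₂(y), where f_q*(y) = q^{−q/(q−1)} (max{1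 + (q−1) y, 0})^{q/(q−1)}. -/
open MeasureTheory Filter Topology
open scoped ENNReal Classical

noncomputable section

/-- The Legendre transform `f_q*` of `f_q(x) = (x^q - x)/(q-1)`. -/
def fqStar (q y : ℝ) : ℝ :=
  q ^ (-(q / (q - 1))) * (max (1 + (q - 1) * y) 0) ^ (q / (q - 1))

theorem fqStar_young (q : ℝ) (hq : 1 < q) (x y : ℝ) (hx : 0 ≤ x) :
    x * y - (x ^ q - x) / (q - 1) ≤ fqStar q y := by
  have hq0 : 0 < q := by linarith
  have hq1 : 0 < q - 1 := by linarith
  set m := max (1 + (q - 1) * y) 0 with hm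
  have hm0 : 0 ≤ m := le_max_right _ _
  have hm1 : 1 + (q - 1) * y ≤ m := le_max_left _ _
  have hconj : q.HolderConjugate (q / (q - 1)) := Real.HolderConjugate.conjExponent hq
  have hY := Real.young_inequality_of_nonneg hx (div_nonneg hm0 hq0.le) hconj
  have hs : fqStar q y = (m / q) ^ (q / (q - 1)) := by
    rw [fqStar, Real.div_rpow hm0 hq0.le, Real.rpow_neg hq0.le, ← hm]
    ring
  rw [hs]
  set S := (m / q) ^ (q / (q - 1))
  have h1 : x * m ≤ x ^ q + (q - 1) * S := by
    have := mul_le_mul_of_nonneg_left hY hq0.le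
    have e1 : q * (x * (m / q)) = x * m := by field_simp
    have e2 : q * (x ^ q / q + S / (q / (q - 1))) = x ^ q + (q - 1) * S := by field_simp
    rwa [e1, e2] at this
  have h2 := mul_le_mul_of_nonneg_left hm1 hx
  have e3 : x * y - (x ^ q - x) / (q - 1) = (x * (1 + (q - 1) * y) - x ^ q) / (q - 1) := by
    field_simp
    ring
  rw [e3, div_le_iff₀ hq1]
  linarith

/-- Weak duality for the Tsallis entropic regularized optimal transport. -/
theorem tsallis_weak_duality
    {X₁ : Type*} [MetricSpace X₁] [CompleteSpace X₁] [TopologicalSpace.SeparableSpace X₁]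
    [MeasurableSpace X₁] [BorelSpace X₁]
    {X₂ : Type*} [MetricSpace X₂] [CompleteSpace X₂] [TopologicalSpace.SeparableSpace X₂]
    [MeasurableSpace X₂] [BorelSpace X₂]
    (μ₁ : Measure X₁) (μ₂ : Measure X₂)
    [IsProbabilityMeasure μ₁] [IsProbabilityMeasure μ₂]
    (c : X₁ × X₂ → ℝ) (hc : Continuous c) (hc0 : ∀ z, 0 ≤ c z)
    (q ε : ℝ) (hq : 1 < q) (hε : 0 < ε)
    (π : Measure (X₁ × X₂)) (hπ : IsCoupling π μ₁ μ₂)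
    (h₁ : X₁ → ℝ) (h₂ : X₂ → ℝ)
    (hh₁ : Integrable h₁ μ₁) (hh₂ : Integrable h₂ μ₂)
    (hstar : Integrable
      (fun z : X₁ × X₂ => fqStar q ((h₁ z.1 + h₂ z.2 - c z) / ε)) (μ₁.prod μ₂)) :
    ENNReal.ofReal
        (∫ x, h₁ x ∂μ₁ + ∫ y, h₂ y ∂μ₂
          - ε * ∫ z, fqStar q ((h₁ z.1 + h₂ z.2 - c z) / ε) ∂(μ₁.prod μ₂))
      ≤ ∫⁻ z, ENNReal.ofReal (c z) ∂π + ENNReal.ofReal ε * tsallisDiv q π (μ₁.prod μ₂) := by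
  set ν := μ₁.prod μ₂ with hν
  obtain ⟨hπ1, hπ2⟩ := hπ
  have hq1 : 0 < q - 1 := by linarith
  have hπp : IsProbabilityMeasure π := by
    constructor
    have : (π.map Prod.fst) Set.univ = 1 := by rw [hπ1]; exact measure_univ
    rwa [Measure.map_apply measurable_fst MeasurableSet.univ, Set.preimage_univ] at this
  by_cases hac : π ≪ ν
  swap
  · have : ENNReal.ofReal ε * tsallisDiv q π ν = ⊤ := by
      rw [tsallisDiv, if_neg hac]
      exact ENNReal.mul_top (by simpa using hε)
    rw [this]; simp
  have hone : ∫⁻ x, π.rnDeriv ν x ∂ν = 1 := by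
    rw [Measure.lintegral_rnDeriv hac]; exact measure_univ
  by_cases hPq : ∫⁻ x, π.rnDeriv ν x ^ q ∂ν = ⊤
  · have : ENNReal.ofReal ε * tsallisDiv q π ν = ⊤ := by
      rw [tsallisDiv, if_pos hac, hone, hPq, ENNReal.top_sub ENNReal.one_ne_top,
        ENNReal.top_div_of_ne_top ENNReal.ofReal_ne_top]
      exact ENNReal.mul_top (by simpa using hε)
    rw [this]; simp
  by_cases hcT : ∫⁻ z, ENNReal.ofReal (c z) ∂π = ⊤
  · rw [hcT]; simp
  have hcm : AEStronglyMeasurable c π := (hc.measurable).aestronglyMeasurable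
  have hcint : Integrable c π :=
    (lintegral_ofReal_ne_top_iff_integrable hcm (ae_of_all _ hc0)).1 hcT
  have hi1 : Integrable (fun z : X₁ × X₂ => h₁ z.1) π :=
    Integrable.comp_measurable (by rw [hπ1]; exact hh₁) measurable_fst
  have hi2 : Integrable (fun z : X₁ × X₂ => h₂ z.2) π :=
    Integrable.comp_measurable (by rw [hπ2]; exact hh₂) measurable_snd
  have he1 : ∫ z, h₁ z.1 ∂π = ∫ x, h₁ x ∂μ₁ := by
    have := integral_map (μ := π) (φ := Prod.fst) measurable_fst.aemeasurable
      (f := h₁) (by rw [hπ1]; exact hh₁.1)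
    rw [← this, hπ1]
  have he2 : ∫ z, h₂ z.2 ∂π = ∫ y, h₂ y ∂μ₂ := by
    have := integral_map (μ := π) (φ := Prod.snd) measurable_snd.aemeasurable
      (f := h₂) (by rw [hπ2]; exact hh₂.1)
    rw [← this, hπ2]
  set P : X₁ × X₂ → ℝ := fun z => (π.rnDeriv ν z).toReal with hP
  have hPi : Integrable P ν := Measure.integrable_toReal_rnDeriv
  have hP1 : ∫ z, P z ∂ν = 1 := by
    rw [hP, Measure.integral_toReal_rnDeriv hac]; simp
  have hPqm : AEMeasurable (fun z => π.rnDeriv ν z ^ q) ν :=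
    ((Measure.measurable_rnDeriv π ν).pow_const q).aemeasurable
  have hPqi : Integrable (fun z => P z ^ q) ν := by
    have := integrable_toReal_of_lintegral_ne_top hPqm hPq
    simpa only [hP, ENNReal.toReal_rpow] using this
  have hPqe : ∫⁻ x, π.rnDeriv ν x ^ q ∂ν = ENNReal.ofReal (∫ z, P z ^ q ∂ν) := by
    have h := integral_toReal hPqm (ae_lt_top' hPqm hPq)
    simp only [hP, ENNReal.toReal_rpow]
    rw [h, ENNReal.ofReal_toReal hPq]
  have hG : Integrable (fun z : X₁ × X₂ => h₁ z.1 + h₂ z.2 - c z) π := (hi1.add hi2).sub hcint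
  have hGe : ∫ z, (h₁ z.1 + h₂ z.2 - c z) ∂π
      = ∫ x, h₁ x ∂μ₁ + ∫ y, h₂ y ∂μ₂ - ∫ z, c z ∂π := by
    have hi12 : Integrable (fun z : X₁ × X₂ => h₁ z.1 + h₂ z.2) π := hi1.add hi2
    rw [integral_sub hi12 hcint, integral_add hi1 hi2, he1, he2]
  have hPG : Integrable (fun z : X₁ × X₂ => P z * (h₁ z.1 + h₂ z.2 - c z)) ν :=
    (integrable_rnDeriv_smul_iff hac).2 hG
  have hPGe : ∫ z, P z * (h₁ z.1 + h₂ z.2 - c z) ∂ν = ∫ z, (h₁ z.1 + h₂ z.2 - c z) ∂π :=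
    integral_rnDeriv_smul hac
  have hI : Integrable (fun z => P z * (h₁ z.1 + h₂ z.2 - c z) / ε
      - (P z ^ q - P z) / (q - 1)) ν :=
    (hPG.div_const ε).sub ((hPqi.sub hPi).div_const (q - 1))
  have hmono : ∫ z, (P z * (h₁ z.1 + h₂ z.2 - c z) / ε - (P z ^ q - P z) / (q - 1)) ∂ν
      ≤ ∫ z, fqStar q ((h₁ z.1 + h₂ z.2 - c z) / ε) ∂ν := by
    refine integral_mono hI hstar fun z => ?_
    have := fqStar_young q hq (P z) ((h₁ z.1 + h₂ z.2 - c z) / ε) ENNReal.toReal_nonneg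
    rwa [← mul_div_assoc] at this
  have hD : Integrable (fun z => (P z ^ q - P z) / (q - 1)) ν :=
    (hPqi.sub hPi).div_const (q - 1)
  rw [integral_sub (hPG.div_const ε) hD, integral_div,
    integral_div, integral_sub hPqi hPi, hPGe, hGe, hP1] at hmono
  have hT : ENNReal.ofReal ε * tsallisDiv q π ν
      = ENNReal.ofReal (ε * ((∫ z, P z ^ q ∂ν - 1) / (q - 1))) := by
    rw [tsallisDiv, if_pos hac, hone, hPqe, ENNReal.ofReal_mul hε.le,
      ENNReal.ofReal_div_of_pos hq1, ENNReal.ofReal_sub (∫ z, P z ^ q ∂ν) zero_le_one, ENNReal.ofReal_one]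
  rw [hT, ← ofReal_integral_eq_lintegral_ofReal hcint (ae_of_all _ hc0)]
  refine le_trans (ENNReal.ofReal_le_ofReal ?_) ENNReal.ofReal_add_le
  have h3 := mul_le_mul_of_nonneg_left hmono hε.le
  rw [mul_sub, mul_div_cancel₀ _ hε.ne'] at h3
  linarith

end
end

section
/- Let X₁ and X₂ be Polish metric spaces, μ₁, μ₂ probability measures on X₁, X₂, c: X₁ × X₂ → [0,∞) continuous, q > 1, and ε > 0. Let K_q be the measure exp_q(−c/ε) · (μ₁⊗μ₂) on X₁ × X₂, where exp_q(−t) = (1 + (q−1) t)^{−1/(q−1)} for t ≥ 0. Then for every probability measure π on X₁ × X₂ with π ≪ μ₁⊗μ₂ and density r = dπ/d(μ₁⊗μ₂), and under the assumption that ∫ c dπ, D_q(π, μ₁⊗μ₂), and ∫ c·log_{2−q}(r) dπ are all finite, one has the identity ∫ c dπ + ε D_q(π, μ₁⊗μ₂) = ε D_q(π, K_q) − (q−1) ∫ c(x,y) log_{2−q}(r(x,y)) dπ(x,y), where log_{2−q}(y) = (y^{q−1} − 1)/(q−1) and D_q(π, K_q) = ∫ log_{2−q}(dπ/dK_q) dπ.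 -/
open MeasureTheory

/-- The `(2-q)`-logarithm, `log_{2-q} y = (y^{q-1} - 1)/(q - 1)`. -/
noncomputable def log2q (q y : ℝ) : ℝ := (y ^ (q - 1) - 1) / (q - 1)

/-- The Tsallis–Gibbs kernel `K_q = exp_q(-c/ε) · (μ₁ ⊗ μ₂)`, where
`exp_q(-t) = (1 + (q-1)t)^{-1/(q-1)}`. -/
noncomputable def tsallisGibbs {X₁ X₂ : Type*} [MeasurableSpace X₁] [MeasurableSpace X₂]
    (q ε : ℝ) (c : X₁ × X₂ → ℝ) (μ₁ : Measure X₁) (μ₂ : Measure X₂) :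
    Measure (X₁ × X₂) :=
  (μ₁.prod μ₂).withDensity fun z =>
    ENNReal.ofReal ((1 + (q - 1) * (c z / ε)) ^ (-(1 / (q - 1))))

/-- Relation between the Tsallis entropic regularized optimal transport functional and the
Tsallis analogue of the Schrödinger bridge problem. -/
theorem tsallis_bridge_identity
    {X₁ : Type*} [MetricSpace X₁] [CompleteSpace X₁] [TopologicalSpace.SeparableSpace X₁]
    [MeasurableSpace X₁] [BorelSpace X₁]
    {X₂ : Type*} [MetricSpace X₂] [CompleteSpace X₂] [TopologicalSpace.SeparableSpace X₂]
    [MeasurableSpace X₂] [BorelSpace X₂]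
    (μ₁ : Measure X₁) (μ₂ : Measure X₂)
    [IsProbabilityMeasure μ₁] [IsProbabilityMeasure μ₂]
    (c : X₁ × X₂ → ℝ) (hc : Continuous c) (hc0 : ∀ z, 0 ≤ c z)
    (q ε : ℝ) (hq : 1 < q) (hε : 0 < ε)
    (π : Measure (X₁ × X₂)) [IsProbabilityMeasure π] (hac : π ≪ μ₁.prod μ₂)
    (hcost : Integrable c π)
    (hD : Integrable
      (fun z => (π.rnDeriv (μ₁.prod μ₂) z).toReal ^ q
        - (π.rnDeriv (μ₁.prod μ₂) z).toReal) (μ₁.prod μ₂))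
    (hclog : Integrable
      (fun z => c z * log2q q (π.rnDeriv (μ₁.prod μ₂) z).toReal) π) :
    ∫ z, c z ∂π
        + ε * ((1 / (q - 1)) *
            ∫ z, ((π.rnDeriv (μ₁.prod μ₂) z).toReal ^ q
              - (π.rnDeriv (μ₁.prod μ₂) z).toReal) ∂(μ₁.prod μ₂))
      = ε * ∫ z, log2q q ((π.rnDeriv (tsallisGibbs q ε c μ₁ μ₂) z).toReal) ∂π
        - (q - 1) * ∫ z, c z * log2q q (π.rnDeriv (μ₁.prod μ₂) z).toReal ∂π := by
  have hsc1 : SecondCountableTopology X₁ := UniformSpace.secondCountable_of_separable X₁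
  have hsc2 : SecondCountableTopology X₂ := UniformSpace.secondCountable_of_separable X₂
  have hq1 : 0 < q - 1 := by linarith
  have hcm : Measurable c := hc.measurable
  have hpos : ∀ z, 0 < 1 + (q - 1) * (c z / ε) := fun z => by
    have := hc0 z
    positivity
  set ν := μ₁.prod μ₂ with hν
  set r : X₁ × X₂ → ℝ := fun z => (π.rnDeriv ν z).toReal with hr
  have hr0 : ∀ z, 0 ≤ r z := fun z => ENNReal.toReal_nonneg
  -- entropy relative to the product measure, as an integral against `π`
  have key : ∀ z, r z ^ q - r z = (q - 1) * (r z • log2q q (r z)) := by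
    intro z
    have h1 : r z ^ q = r z * r z ^ (q - 1) := by
      rcases (hr0 z).eq_or_lt with h | h
      · rw [← h, Real.zero_rpow (by linarith), zero_mul]
      · rw [Real.rpow_sub_one h.ne', mul_div_cancel₀ _ h.ne']
    rw [h1, log2q, smul_eq_mul]
    field_simp
  have hDπ : Integrable (fun z => log2q q (r z)) π := by
    rw [← integrable_rnDeriv_smul_iff hac]
    have h2 : Integrable (fun z => (1 / (q - 1)) * (r z ^ q - r z)) ν := hD.const_mul _
    refine h2.congr (Filter.Eventually.of_forall fun z => ?_)
    simp only [key]
    field_simp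
    rfl
  have hDeq : ∫ z, (r z ^ q - r z) ∂ν = (q - 1) * ∫ z, log2q q (r z) ∂π := by
    rw [← integral_rnDeriv_smul hac, ← integral_const_mul]
    exact integral_congr_ae (Filter.Eventually.of_forall key)
  -- the density with respect to the Gibbs kernel
  have hK : ∀ᵐ z ∂π, log2q q ((π.rnDeriv (tsallisGibbs q ε c μ₁ μ₂) z).toReal)
      = log2q q (r z) + (1 / ε) * c z + ((q - 1) / ε) * (c z * log2q q (r z)) := by
    have h3 : π.rnDeriv (tsallisGibbs q ε c μ₁ μ₂) =ᵐ[ν] _ :=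
      Measure.rnDeriv_withDensity_right π ν
        (f := fun z => ENNReal.ofReal ((1 + (q - 1) * (c z / ε)) ^ (-(1 / (q - 1)))))
        (by fun_prop)
        (Filter.Eventually.of_forall fun z => by
          simpa using Real.rpow_pos_of_pos (hpos z) _)
        (Filter.Eventually.of_forall fun z => ENNReal.ofReal_ne_top)
    filter_upwards [hac.ae_le h3] with z hz
    have h4 : ((π.rnDeriv (tsallisGibbs q ε c μ₁ μ₂) z).toReal)
        = (1 + (q - 1) * (c z / ε)) ^ (1 / (q - 1)) * r z := by
      rw [hz, ENNReal.toReal_mul, ENNReal.toReal_inv,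
        ENNReal.toReal_ofReal (Real.rpow_nonneg (hpos z).le _), Real.rpow_neg (hpos z).le,
        inv_inv]
    rw [h4, log2q, Real.mul_rpow (Real.rpow_nonneg (hpos z).le _) (hr0 z),
      ← Real.rpow_mul (hpos z).le, one_div_mul_cancel hq1.ne', Real.rpow_one, log2q]
    field_simp
    ring
  have hclog' : Integrable (fun z => c z * log2q q (r z)) π := hclog
  have hsum : Integrable (fun z => log2q q (r z) + (1 / ε) * c z) π :=
    hDπ.add (hcost.const_mul _)
  rw [integral_congr_ae hK, integral_add hsum (hclog'.const_mul _),
    integral_add hDπ (hcost.const_mul _), integral_const_mul, integral_const_mul]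
  change _ + ε * ((1 / (q - 1)) * ∫ z, (r z ^ q - r z) ∂ν)
    = _ - (q - 1) * ∫ z, c z * log2q q (r z) ∂π
  rw [hDeq]
  field_simp
  ring
end
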